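/- Let ρ be a subnormalized quantum state and Γ a positive-semidefinite matrix on ℂ^d, let M be a set of POVM effects on ℂ^d, and let η ∈ (0, tr ρ]. Then 0 ≤ D_{h,M}^η(ρ‖Γ) − D_M^η(ρ‖Γ) ≤ log(1/η), where D_{h,M}^η(ρ‖Γ) := −log( inf { tr(QΓ) : Q ∈ M, tr(Qρ) ≥ η } ) is the reduced complexity relative entropy. Equivalently, 0 ≤ H_M^η(ρ) − H_{h,M}^η(ρ) ≤ log(1/η), where H_{h,M}^η(ρ) := log( inf { tr(Q) : Q ∈ M, tr(Qρ) ≥ η } ). Moreover, if ρ is normalized and η = 1, then D_{h,M}^{1}(ρ‖Γ) = D_M^{1}(ρ‖Γ) and H_{h,M}^{1}(ρ) = H_M^{1}(ρ). -/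

import Mathlib

open Matrix
open scoped ComplexOrder

noncomputable section

/-- A POVM effect on `ℂ^d`: `0 ≤ Q ≤ I` in the Loewner order. -/
def IsEffect {d : ℕ} (Q : Matrix (Fin d) (Fin d) ℂ) : Prop :=
  Q.PosSemidef ∧ (1 - Q).PosSemidef

/-- Real part of the trace. -/
def trRe {d : ℕ} (A : Matrix (Fin d) (Fin d) ℂ) : ℝ := (A.trace).re

/-- Complexity relative entropy `D_M^η(ρ‖Γ) := −log( inf { tr(QΓ)/tr(Qρ) : Q ∈ M, tr(Qρ) ≥ η } )`,
valued in extended reals; the infimum over the empty set is `∞`, so `D = −∞` in that case. -/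
def Dc {d : ℕ} (M : Set (Matrix (Fin d) (Fin d) ℂ))
    (ρ Γ : Matrix (Fin d) (Fin d) ℂ) (η : ℝ) : EReal :=
  - ENNReal.log (⨅ Q ∈ {Q | Q ∈ M ∧ η ≤ trRe (Q * ρ)},
      ENNReal.ofReal (trRe (Q * Γ) / trRe (Q * ρ)))

/-- Complexity entropy `H_M^η(ρ) := −D_M^η(ρ‖I)`. -/
def Hc {d : ℕ} (M : Set (Matrix (Fin d) (Fin d) ℂ))
    (ρ : Matrix (Fin d) (Fin d) ℂ) (η : ℝ) : EReal :=
  - Dc M ρ 1 η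

/-- Reduced complexity relative entropy
`D_{h,M}^η(ρ‖Γ) := −log( inf { tr(QΓ) : Q ∈ M, tr(Qρ) ≥ η } )`. -/
def Dh {d : ℕ} (M : Set (Matrix (Fin d) (Fin d) ℂ))
    (ρ Γ : Matrix (Fin d) (Fin d) ℂ) (η : ℝ) : EReal :=
  - ENNReal.log (⨅ Q ∈ {Q | Q ∈ M ∧ η ≤ trRe (Q * ρ)},
      ENNReal.ofReal (trRe (Q * Γ)))

/-- Reduced complexity entropy `H_{h,M}^η(ρ) := log( inf { tr(Q) : Q ∈ M, tr(Qρ) ≥ η } )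
(equivalently `−D_{h,M}^η(ρ‖I)`). -/
def Hh {d : ℕ} (M : Set (Matrix (Fin d) (Fin d) ℂ))
    (ρ : Matrix (Fin d) (Fin d) ℂ) (η : ℝ) : EReal :=
  - Dh M ρ 1 η

open scoped MatrixOrder in
lemma trRe_mul_nonneg {d : ℕ} {A B : Matrix (Fin d) (Fin d) ℂ}
    (hA : A.PosSemidef) (hB : B.PosSemidef) : 0 ≤ trRe (A * B) := by
  obtain ⟨C, rfl⟩ := CStarAlgebra.nonneg_iff_eq_star_mul_self.mp hA.nonneg
  have h := (hB.mul_mul_conjTranspose_same C).trace_nonneg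
  rw [Matrix.trace_mul_comm, ← mul_assoc] at h
  exact (Complex.nonneg_iff.mp h).1

lemma IsEffect.trRe_mul_le {d : ℕ} {Q ρ : Matrix (Fin d) (Fin d) ℂ}
    (hQ : IsEffect Q) (hρ : ρ.PosSemidef) : trRe (Q * ρ) ≤ trRe ρ := by
  have h := trRe_mul_nonneg hQ.2 hρ
  simpa [trRe, sub_mul] using h

lemma EReal.neg_le_neg_add_coe {x y : EReal} {r : ℝ} (h : x ≤ y + r) : -y ≤ -x + r := by
  rw [← EReal.sub_le_iff_le_add (by simp) (by simp)] at h
  rw [← EReal.neg_le_neg_iff, EReal.neg_add (by simp) (by simp)]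
  simpa using h

lemma Dc_le_Dh {d : ℕ} {M : Set (Matrix (Fin d) (Fin d) ℂ)} (hM : ∀ Q ∈ M, IsEffect Q)
    {ρ Γ : Matrix (Fin d) (Fin d) ℂ} (hρ : ρ.PosSemidef) (hρtr : trRe ρ ≤ 1)
    (hΓ : Γ.PosSemidef) {η : ℝ} (hη : 0 < η) : Dc M ρ Γ η ≤ Dh M ρ Γ η := by
  refine EReal.neg_le_neg_iff.mpr (ENNReal.log_le_log (iInf₂_mono fun Q hQ => ?_))
  exact ENNReal.ofReal_le_ofReal (le_div_self (trRe_mul_nonneg (hM Q hQ.1).1 hΓ)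
    (hη.trans_le hQ.2) (((hM Q hQ.1).trRe_mul_le hρ).trans hρtr))

lemma Dh_le_Dc_add_log {d : ℕ} {M : Set (Matrix (Fin d) (Fin d) ℂ)}
    (hM : ∀ Q ∈ M, IsEffect Q) (ρ : Matrix (Fin d) (Fin d) ℂ) {Γ : Matrix (Fin d) (Fin d) ℂ}
    (hΓ : Γ.PosSemidef) {η : ℝ} (hη : 0 < η) :
    Dh M ρ Γ η ≤ Dc M ρ Γ η + ((Real.log (1 / η) : ℝ) : EReal) := by
  have hη' : 0 < 1 / η := by positivity
  refine EReal.neg_le_neg_add_coe ?_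
  rw [← ENNReal.log_ofReal_of_pos hη', ← ENNReal.log_mul_add]
  refine ENNReal.log_le_log ?_
  have h0 : ENNReal.ofReal (1 / η) ≠ 0 := by simpa using hη
  simp only [ENNReal.iInf_mul_of_ne h0 ENNReal.ofReal_ne_top]
  refine iInf₂_mono fun Q hQ => ?_
  have hnn := trRe_mul_nonneg (hM Q hQ.1).1 hΓ
  rw [← ENNReal.ofReal_mul hnn, mul_one_div]
  exact ENNReal.ofReal_le_ofReal (div_le_div_of_nonneg_left hnn hη hQ.2)

/-- The reduced complexity (relative) entropy differs from the complexity
(relative) entropy by at most `log(1/η)`: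
`0 ≤ D_{h,M}^η(ρ‖Γ) − D_M^η(ρ‖Γ) ≤ log(1/η)` and
`0 ≤ H_M^η(ρ) − H_{h,M}^η(ρ) ≤ log(1/η)`, with equality of the two versions when `ρ` is
normalized and `η = 1`. -/
theorem stmt10 {d : ℕ} (M : Set (Matrix (Fin d) (Fin d) ℂ)) (hM : ∀ Q ∈ M, IsEffect Q)
    (ρ Γ : Matrix (Fin d) (Fin d) ℂ)
    (hρ : ρ.PosSemidef) (hρtr : trRe ρ ≤ 1) (hΓ : Γ.PosSemidef)
    (η : ℝ) (hη : 0 < η) (hη' : η ≤ trRe ρ) :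
    (Dc M ρ Γ η ≤ Dh M ρ Γ η ∧
      Dh M ρ Γ η ≤ Dc M ρ Γ η + ((Real.log (1 / η) : ℝ) : EReal)) ∧
    (Hh M ρ η ≤ Hc M ρ η ∧
      Hc M ρ η ≤ Hh M ρ η + ((Real.log (1 / η) : ℝ) : EReal)) ∧
    (trRe ρ = 1 → η = 1 → Dh M ρ Γ η = Dc M ρ Γ η ∧ Hh M ρ η = Hc M ρ η) := by
  have h₁ := Dc_le_Dh hM hρ hρtr hΓ hη
  have h₂ := Dh_le_Dc_add_log hM ρ hΓ hη
  have h₃ := Dc_le_Dh hM hρ hρtr Matrix.PosSemidef.one hη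
  have h₄ := Dh_le_Dc_add_log hM ρ Matrix.PosSemidef.one hη
  refine ⟨⟨h₁, h₂⟩, ⟨EReal.neg_le_neg_iff.mpr h₃, EReal.neg_le_neg_add_coe h₄⟩, ?_⟩
  rintro - rfl
  simp only [div_one, Real.log_one, EReal.coe_zero, add_zero] at h₂ h₄
  exact ⟨le_antisymm h₂ h₁, congrArg Neg.neg (le_antisymm h₄ h₃)⟩

end
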